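/- arXiv:1910.01623 — 2 statements merged into one kernel-verified Lean document; each statement's English description precedes it below -/
import Mathlib

section
/- Let n ≥ d+2 and 2 ≤ k ≤ n. Let X be an n×d random matrix with independent N(0,1) entries, ε ∈ ℝⁿ a vector of i.i.d. N(0,1) entries, and π* a permutation drawn uniformly at random from the set of permutations of {1,…,n} moving exactly k indices, with X, ε, π* jointly independent. Set y = Π* X β* + σ* ε, where β* ∈ ℝ^d, σ* > 0, and Π* is the permutation matrix of π*. Then the ordinary least squares estimator β̂^LS = (XᵀX)⁻¹Xᵀy satisfies E[β̂^LS] = (1 − α*) β*, where α* = k/n. -/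
open MeasureTheory ProbabilityTheory Matrix
open scoped BigOperators ENNReal

instance (n : ℕ) : MeasurableSpace (Equiv.Perm (Fin n)) := ⊤

/-- The set of permutations of `{1,…,n}` moving exactly `k` indices. -/
def movesExactly (n k : ℕ) : Finset (Equiv.Perm (Fin n)) :=
  Finset.univ.filter fun σ => (Finset.univ.filter fun i => σ i ≠ i).card = k

lemma exists_orthonormal_rows_mul_eq_zero {m n d : ℕ} (h : d + m ≤ n)
    (W : Matrix (Fin n) (Fin d) ℝ) :
    ∃ U : Matrix (Fin m) (Fin n) ℝ, U * Uᵀ = 1 ∧ U * W = 0 := by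
  let S : Submodule ℝ (EuclideanSpace ℝ (Fin n)) :=
    Submodule.span ℝ (Set.range fun j => WithLp.toLp 2 (fun i => W i j))
  have hS : Module.finrank ℝ S ≤ d := by
    have := finrank_range_le_card (R := ℝ)
      (fun j : Fin d => (WithLp.toLp 2 (fun i => W i j) : EuclideanSpace ℝ (Fin n)))
    rwa [Fintype.card_fin] at this
  have hm : m ≤ Module.finrank ℝ Sᗮ := by
    have := S.finrank_add_finrank_orthogonal
    rw [finrank_euclideanSpace_fin] at this
    omega
  let b := stdOrthonormalBasis ℝ Sᗮ
  refine ⟨Matrix.of fun k i => (b (Fin.castLE hm k) : EuclideanSpace ℝ (Fin n)) i, ?_, ?_⟩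
  · ext k l
    have := (orthonormal_iff_ite.1 b.orthonormal) (Fin.castLE hm l) (Fin.castLE hm k)
    rw [Submodule.coe_inner, PiLp.inner_apply] at this
    rw [Matrix.mul_apply, Matrix.one_apply]
    refine Eq.trans ?_ (this.trans ?_)
    · rfl
    · simp [eq_comm]
  · ext k j
    have hW : (WithLp.toLp 2 (fun i => W i j) : EuclideanSpace ℝ (Fin n)) ∈ S :=
      Submodule.subset_span ⟨j, rfl⟩
    have := (b (Fin.castLE hm k)).2 _ hW
    rw [PiLp.inner_apply] at this
    rw [Matrix.mul_apply]
    exact this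

lemma map_mulVec_pi_gaussianReal {m n : Type*} [Fintype m] [Fintype n] [DecidableEq m]
    (U : Matrix m n ℝ) (hU : U * Uᵀ = 1) :
    (Measure.pi fun _ : n => gaussianReal 0 1).map U.mulVec
      = Measure.pi fun _ : m => gaussianReal 0 1 := by
  have hUm : Measurable U.mulVec := by unfold Matrix.mulVec dotProduct; fun_prop
  apply (MeasurableEquiv.toLp 2 (m → ℝ)).map_measurableEquiv_injective
  rw [MeasurableEquiv.coe_toLp, map_pi_eq_stdGaussian]
  apply Measure.ext_of_charFun (E := EuclideanSpace ℝ m)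
  ext t
  have hn : ‖(WithLp.toLp 2 (Uᵀ.mulVec t) : EuclideanSpace ℝ n)‖ ^ 2 = ‖t‖ ^ 2 := by
    have h1 : Uᵀ.mulVec t.ofLp ⬝ᵥ Uᵀ.mulVec t.ofLp = t.ofLp ⬝ᵥ t.ofLp := by
      rw [Matrix.dotProduct_mulVec, Matrix.vecMul_transpose, Matrix.mulVec_mulVec, hU,
        Matrix.one_mulVec]
    rw [EuclideanSpace.real_norm_sq_eq, EuclideanSpace.real_norm_sq_eq]
    simpa [dotProduct, sq] using h1
  rw [charFun_stdGaussian, ← Complex.ofReal_pow, ← hn, Complex.ofReal_pow, ← charFun_stdGaussian, ← map_pi_eq_stdGaussian,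
    charFun_apply, charFun_apply, integral_map (by fun_prop) (by fun_prop),
    integral_map (by fun_prop) (by fun_prop), integral_map (by fun_prop) (by fun_prop)]
  congr! 4 with x
  have : U.mulVec x ⬝ᵥ t.ofLp = x ⬝ᵥ Uᵀ.mulVec t.ofLp := by
    rw [Matrix.dotProduct_mulVec, Matrix.vecMul_transpose]
  rw [PiLp.inner_apply, PiLp.inner_apply]
  simp only [RCLike.inner_apply, conj_trivial]
  simpa [dotProduct, mul_comm] using congrArg Complex.ofReal this

lemma lintegral_abs_rpow_gaussianReal_lt_top :
    ∫⁻ x, (ENNReal.ofReal (x ^ 2) ^ (1 / 3 : ℝ))⁻¹ ∂(gaussianReal 0 1) < ⊤ := by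
  have h0 : IntegrableOn (fun x : ℝ => x ^ (-2 / 3 : ℝ) * Real.exp (-(1 / 2) * x ^ 2))
      (Set.Ioi 0) :=
    integrableOn_rpow_mul_exp_neg_mul_sq (by norm_num) (by norm_num)
  have h1 : Integrable (fun x : ℝ => |x| ^ (-2 / 3 : ℝ) * Real.exp (-(1 / 2) * x ^ 2)) := by
    have h2 : IntegrableOn (fun x : ℝ => |x| ^ (-2 / 3 : ℝ) * Real.exp (-(1 / 2) * x ^ 2))
        (Set.Ioi 0) := by
      refine h0.congr_fun (fun x hx => ?_) measurableSet_Ioi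
      simp only [abs_of_pos (Set.mem_Ioi.1 hx)]
    have h3 : IntegrableOn (fun x : ℝ => |x| ^ (-2 / 3 : ℝ) * Real.exp (-(1 / 2) * x ^ 2))
        (Set.Iic 0) := by
      rw [← Measure.map_neg_eq_self (volume : Measure ℝ)]
      have m : MeasurableEmbedding fun x : ℝ => -x := (Homeomorph.neg ℝ).measurableEmbedding
      rw [m.integrableOn_map_iff]
      simp_rw [Function.comp_def, abs_neg, neg_sq, Set.neg_preimage, Set.neg_Iic, neg_zero]
      exact (Iff.mpr integrableOn_Ici_iff_integrableOn_Ioi) h2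
    rw [← integrableOn_univ, ← Set.Iic_union_Ioi (a := (0 : ℝ))]
    exact h3.union h2
  rw [gaussianReal_of_var_ne_zero _ one_ne_zero,
    lintegral_withDensity_eq_lintegral_mul _ (by fun_prop) (by fun_prop)]
  refine lt_of_le_of_lt (lintegral_mono_ae ?_) (h1.const_mul (√(2 * Real.pi * (1 : NNReal)))⁻¹).2
  filter_upwards [Measure.ae_ne volume (0 : ℝ)] with x hx
  have hx' : 0 < x ^ 2 := by positivity
  have hr : (x ^ 2) ^ (1 / 3 : ℝ) = (|x| ^ (-2 / 3 : ℝ))⁻¹ := by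
    rw [← sq_abs, ← Real.rpow_natCast, ← Real.rpow_mul (abs_nonneg x), ← Real.rpow_neg (abs_nonneg x)]
    norm_num
  rw [Pi.mul_apply, gaussianPDF, gaussianPDFReal, ENNReal.ofReal_rpow_of_pos hx',
    ← ENNReal.ofReal_inv_of_pos (by positivity), ← ENNReal.ofReal_mul (by positivity), hr, inv_inv,
    Real.enorm_of_nonneg (by positivity)]
  apply le_of_eq
  congr 1
  rw [mul_assoc, mul_comm (Real.exp _)]
  congr 3
  simp
  ring

lemma lintegral_inv_sum_sq_lt_top :
    ∫⁻ z, (ENNReal.ofReal (∑ i, z i ^ 2))⁻¹ ∂(Measure.pi fun _ : Fin 3 => gaussianReal 0 1) < ⊤ := by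
  have hind := lintegral_prod_eq_prod_lintegral_of_indepFun (μ := Measure.pi fun _ : Fin 3 => gaussianReal 0 1) Finset.univ
    (fun i z => (ENNReal.ofReal (z i ^ 2) ^ (1 / 3 : ℝ))⁻¹)
    (iIndepFun_pi (X := fun _ x => (ENNReal.ofReal (x ^ 2) ^ (1 / 3 : ℝ))⁻¹)
      (fun i => by fun_prop)) (fun i => by fun_prop)
  calc _ ≤ ∫⁻ z, ∏ i, (ENNReal.ofReal (z i ^ 2) ^ (1 / 3 : ℝ))⁻¹ ∂(Measure.pi fun _ : Fin 3 => gaussianReal 0 1) := by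
        refine lintegral_mono fun z => ?_
        simp only
        rw [← ENNReal.prod_inv_distrib (by intro i _ j _ _; right; finiteness), ENNReal.inv_le_inv]
        calc _ ≤ ∏ i : Fin 3, ENNReal.ofReal (∑ i, z i ^ 2) ^ (1 / 3 : ℝ) := by
              gcongr with i
              exact Finset.single_le_sum (f := fun i => z i ^ 2) (fun i _ => sq_nonneg _) (Finset.mem_univ i)
          _ = _ := by
            rw [Finset.prod_const, ← ENNReal.rpow_natCast, ← ENNReal.rpow_mul]
            norm_num
    _ < ⊤ := by
        rw [hind]
        refine ENNReal.prod_lt_top fun i _ => ?_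
        have := (measurePreserving_eval (fun _ : Fin 3 => gaussianReal 0 1) i).lintegral_comp (f := fun x => (ENNReal.ofReal (x ^ 2) ^ (1 / 3 : ℝ))⁻¹) (by fun_prop)
        simp only [Function.eval] at this
        rw [this]
        exact lintegral_abs_rpow_gaussianReal_lt_top

/-- The law of an `n × d` matrix with independent standard Gaussian entries. -/
noncomputable abbrev gaussianMatrix (n d : ℕ) : Measure (Fin n → Fin d → ℝ) :=
  Measure.pi fun _ : Fin n => Measure.pi fun _ : Fin d => gaussianReal 0 1

/-- The matrix `(XᵀX)⁻¹Xᵀ` mapping a response vector to its OLS estimator. -/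
noncomputable def olsMatrix {n d : ℕ} (X : Matrix (Fin n) (Fin d) ℝ) :
    Matrix (Fin d) (Fin n) ℝ :=
  (Xᵀ * X)⁻¹ * Xᵀ

lemma measurePreserving_insertNth_col (n d : ℕ) (a : Fin (d + 1)) :
    MeasurePreserving
      (fun p : (Fin n → Fin d → ℝ) × (Fin n → ℝ) => fun i => a.insertNth (p.2 i) (p.1 i) :
        _ → Fin n → Fin (d + 1) → ℝ)
      ((gaussianMatrix n d).prod (Measure.pi fun _ : Fin n => gaussianReal 0 1))
      (gaussianMatrix n (d + 1)) := by
  have h1 := (measurePreserving_piFinSuccAbove (fun _ : Fin (d + 1) => gaussianReal 0 1) a).symm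
  have h2 := measurePreserving_pi (fun _ : Fin n => _) (fun _ : Fin n => _) (fun _ => h1)
  have h3 := (measurePreserving_arrowProdEquivProdArrow ℝ (Fin d → ℝ) (Fin n)
    (fun _ => gaussianReal 0 1) (fun _ => Measure.pi fun _ : Fin d => gaussianReal 0 1)).symm
  exact h2.comp (h3.comp Measure.measurePreserving_swap)

lemma measurable_det_of_entries {α m : Type*} [MeasurableSpace α] [Fintype m] [DecidableEq m]
    {M : α → Matrix m m ℝ} (hM : ∀ i j, Measurable fun x => M x i j) :
    Measurable fun x => (M x).det := by
  simp_rw [Matrix.det_apply]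
  refine Finset.measurable_sum _ fun σ _ => ?_
  exact (Finset.measurable_prod _ fun i _ => hM _ _).const_smul _

lemma measurable_det_gram (n d : ℕ) :
    Measurable fun X : Fin n → Fin d → ℝ => ((Matrix.of X)ᵀ * Matrix.of X).det := by
  refine measurable_det_of_entries fun i j => ?_
  simp only [Matrix.mul_apply, Matrix.transpose_apply, Matrix.of_apply]
  fun_prop

lemma measurable_olsMatrix {n d : ℕ} (a : Fin d) (i : Fin n) :
    Measurable fun X : Fin n → Fin d → ℝ => olsMatrix (Matrix.of X) a i := by
  simp only [olsMatrix, Matrix.mul_apply, Matrix.inv_def, Matrix.smul_apply, Ring.inverse_eq_inv',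
    smul_eq_mul]
  refine Finset.measurable_sum _ fun b _ => ?_
  refine ((measurable_det_gram n d).inv.mul ?_).mul
    (by simp only [Matrix.transpose_apply, Matrix.of_apply]; fun_prop)
  simp only [Matrix.adjugate_apply]
  refine measurable_det_of_entries fun j k => ?_
  simp only [Matrix.updateRow_apply, Matrix.mul_apply, Matrix.transpose_apply, Matrix.of_apply]
  split_ifs <;> fun_prop

lemma olsMatrix_mul_self {n d : ℕ} {X : Matrix (Fin n) (Fin d) ℝ} (hX : (Xᵀ * X).det ≠ 0) :
    olsMatrix X * X = 1 := by
  rw [olsMatrix, Matrix.mul_assoc, Matrix.nonsing_inv_mul _ (isUnit_iff_ne_zero.2 hX)]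

lemma dotProduct_mulVec_self_le {m n : Type*} [Fintype m] [Fintype n] [DecidableEq m]
    (U : Matrix m n ℝ) (hU : U * Uᵀ = 1) (w : n → ℝ) :
    U.mulVec w ⬝ᵥ U.mulVec w ≤ w ⬝ᵥ w := by
  have h0 : 0 ≤ (w - Uᵀ.mulVec (U.mulVec w)) ⬝ᵥ (w - Uᵀ.mulVec (U.mulVec w)) :=
    Finset.sum_nonneg fun i _ => mul_self_nonneg _
  have h1 : w ⬝ᵥ Uᵀ.mulVec (U.mulVec w) = U.mulVec w ⬝ᵥ U.mulVec w := by
    rw [Matrix.dotProduct_mulVec, Matrix.vecMul_transpose]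
  have h2 : Uᵀ.mulVec (U.mulVec w) ⬝ᵥ Uᵀ.mulVec (U.mulVec w) = U.mulVec w ⬝ᵥ U.mulVec w := by
    rw [Matrix.dotProduct_mulVec, Matrix.vecMul_transpose, Matrix.mulVec_mulVec _ U Uᵀ, hU,
      Matrix.one_mulVec]
  rw [sub_dotProduct, dotProduct_sub, dotProduct_sub, h2, dotProduct_comm (Uᵀ.mulVec _) w, h1] at h0
  linarith

lemma ofReal_olsMatrix_sq_le {m n d : ℕ} (X : Matrix (Fin n) (Fin d) ℝ)
    (U : Matrix (Fin m) (Fin n) ℝ) (hU : U * Uᵀ = 1) (a : Fin d)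
    (hUX : ∀ k, ∀ b ≠ a, (U * X) k b = 0) (i : Fin n) :
    ENNReal.ofReal (olsMatrix X a i ^ 2) ≤ (ENNReal.ofReal (∑ k, (U * X) k a ^ 2))⁻¹ := by
  by_cases hX : (Xᵀ * X).det = 0
  · have : olsMatrix X = 0 := by
      rw [olsMatrix, Matrix.nonsing_inv_apply_not_isUnit _ (by simp [hX]), Matrix.zero_mul]
    simp [this]
  set w : Fin n → ℝ := olsMatrix X a with hw
  set c := (Xᵀ * X)⁻¹ a a with hc
  have hGT : ((Xᵀ * X)⁻¹)ᵀ = (Xᵀ * X)⁻¹ := by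
    rw [Matrix.transpose_nonsing_inv, Matrix.transpose_mul, Matrix.transpose_transpose]
  have hAT : (olsMatrix X)ᵀ = X * (Xᵀ * X)⁻¹ := by
    rw [olsMatrix, Matrix.transpose_mul, hGT, Matrix.transpose_transpose]
  have hww : w ⬝ᵥ w = c := by
    have : (olsMatrix X * (olsMatrix X)ᵀ) a a = c := by
      rw [hAT, ← Matrix.mul_assoc, olsMatrix_mul_self hX, Matrix.one_mul]
    rw [← this]; rfl
  have hUw : ∀ k, U.mulVec w k = (U * X) k a * c := by
    intro k
    have : (U * (olsMatrix X)ᵀ) k a = (U * X) k a * c := by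
      rw [hAT, ← Matrix.mul_assoc, Matrix.mul_apply,
        Finset.sum_eq_single a (fun b _ hb => by rw [hUX k b hb, zero_mul]) (by simp)]
    rw [← this]; rfl
  have hbessel := dotProduct_mulVec_self_le U hU w
  have hS : U.mulVec w ⬝ᵥ U.mulVec w = c * (c * ∑ k, (U * X) k a ^ 2) := by
    simp only [dotProduct, hUw, Finset.mul_sum]
    exact Finset.sum_congr rfl fun k _ => by ring
  have hwi : w i ^ 2 ≤ c := by
    rw [← hww, dotProduct, sq]
    exact Finset.single_le_sum (f := fun i => w i * w i) (fun i _ => mul_self_nonneg _)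
      (Finset.mem_univ i)
  have hc0 : 0 ≤ c := (sq_nonneg _).trans hwi
  have hcS : c * ∑ k, (U * X) k a ^ 2 ≤ 1 := by
    rcases hc0.eq_or_lt with h | h
    · rw [← h]; simp
    · rw [hS, hww] at hbessel
      nlinarith
  refine (ENNReal.ofReal_le_ofReal hwi).trans ?_
  rw [ENNReal.le_inv_iff_mul_le, ← ENNReal.ofReal_mul hc0]
  exact ENNReal.ofReal_le_one.2 hcS

lemma mul_of_insertNth {m n d : ℕ} (U : Matrix (Fin m) (Fin n) ℝ) (a : Fin (d + 1))
    (x : Fin n → ℝ) (W : Fin n → Fin d → ℝ) (k : Fin m) (b : Fin (d + 1)) :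
    (U * Matrix.of fun i => (a.insertNth (x i) (W i) : Fin (d + 1) → ℝ)) k b
      = (a.insertNth (U.mulVec x k) ((U * Matrix.of W) k) : Fin (d + 1) → ℝ) b := by
  refine Fin.succAboveCases a ?_ (fun b => ?_) b <;>
    simp [Matrix.mul_apply, Matrix.mulVec, dotProduct]

lemma lintegral_inv_sum_mulVec_sq {n : ℕ} (U : Matrix (Fin 3) (Fin n) ℝ)
    (hU : U * Uᵀ = 1) :
    ∫⁻ x, (ENNReal.ofReal (∑ k, U.mulVec x k ^ 2))⁻¹
        ∂(Measure.pi fun _ : Fin n => gaussianReal 0 1)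
      = ∫⁻ z, (ENNReal.ofReal (∑ i, z i ^ 2))⁻¹
        ∂(Measure.pi fun _ : Fin 3 => gaussianReal 0 1) := by
  have hUm : Measurable U.mulVec := by unfold Matrix.mulVec dotProduct; fun_prop
  rw [← map_mulVec_pi_gaussianReal U hU, lintegral_map (by fun_prop) hUm]

lemma lintegral_olsMatrix_sq_lt_top {n d : ℕ} (h : d + 2 ≤ n) (a : Fin d) (i : Fin n) :
    ∫⁻ X, ENNReal.ofReal (olsMatrix (Matrix.of X) a i ^ 2) ∂(gaussianMatrix n d) < ⊤ := by
  obtain _ | d := d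
  · exact a.elim0
  have hmp := measurePreserving_insertNth_col n d a
  have hm : Measurable fun X : Fin n → Fin (d + 1) → ℝ =>
      ENNReal.ofReal (olsMatrix (Matrix.of X) a i ^ 2) :=
    ((measurable_olsMatrix a i).pow_const 2).ennreal_ofReal
  rw [← hmp.lintegral_comp hm]
  refine (lintegral_prod _ (hm.comp hmp.measurable).aemeasurable).trans_lt ?_
  refine lt_of_le_of_lt (lintegral_mono (g := fun _ => _) fun W => ?_)
    ((lintegral_const _).trans_lt
      (ENNReal.mul_lt_top lintegral_inv_sum_sq_lt_top (measure_lt_top _ _)))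
  obtain ⟨U, hU, hUW⟩ := exists_orthonormal_rows_mul_eq_zero (m := 3) (by omega) (Matrix.of W)
  rw [← lintegral_inv_sum_mulVec_sq U hU]
  refine lintegral_mono fun x => ?_
  refine (ofReal_olsMatrix_sq_le _ U hU a (fun k b hb => ?_) i).trans_eq ?_
  · obtain ⟨b, rfl⟩ := Fin.exists_succAbove_eq hb
    rw [mul_of_insertNth, hUW]
    simp
  · simp [mul_of_insertNth]

lemma det_gram_ne_zero_iff {n d : ℕ} (X : Matrix (Fin n) (Fin d) ℝ) :
    (Xᵀ * X).det ≠ 0 ↔ ∀ v, X.mulVec v = 0 → v = 0 := by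
  rw [Ne, ← Matrix.exists_mulVec_eq_zero_iff]
  push Not
  refine ⟨fun h v hv => ?_, fun h v hv hXv => hv (h v ?_)⟩
  · by_contra hne
    exact h v hne (by rw [← Matrix.mulVec_mulVec, hv, Matrix.mulVec_zero])
  · have : X.mulVec v ⬝ᵥ X.mulVec v = 0 := by
      rw [Matrix.dotProduct_mulVec, ← Matrix.mulVec_transpose, Matrix.mulVec_mulVec, hXv,
        zero_dotProduct]
    exact dotProduct_self_eq_zero.1 this

lemma ae_det_gram_ne_zero {n d : ℕ} (h : d + 2 ≤ n) :
    ∀ᵐ X ∂(gaussianMatrix n d), ((Matrix.of X)ᵀ * Matrix.of X).det ≠ 0 := by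
  induction d with
  | zero => simp
  | succ d ih =>
    have hmp := measurePreserving_insertNth_col n d 0
    have hms : MeasurableSet {X : Fin n → Fin (d + 1) → ℝ |
        ((Matrix.of X)ᵀ * Matrix.of X).det ≠ 0} :=
      measurableSet_eq_fun (measurable_det_gram n (d + 1)) measurable_const |>.compl
    rw [← hmp.map_eq, ae_map_iff hmp.measurable.aemeasurable hms]
    refine (Measure.ae_prod_iff_ae_ae (hmp.measurable hms)).2 ?_
    filter_upwards [ih (by omega)] with W hW
    obtain ⟨U, hU, hUW⟩ := exists_orthonormal_rows_mul_eq_zero (m := 3) (by omega) (Matrix.of W)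
    have hfin := lintegral_inv_sum_mulVec_sq U hU ▸ lintegral_inv_sum_sq_lt_top
    have hUm : Measurable U.mulVec := by unfold Matrix.mulVec dotProduct; fun_prop
    filter_upwards [ae_lt_top (by fun_prop) hfin.ne] with x hx
    rw [det_gram_ne_zero_iff] at hW ⊢
    intro v hv
    have hv' : ∀ i, x i * v 0 + ∑ j, W i j * v j.succ = 0 := fun i => by
      simpa [Matrix.mulVec, dotProduct, Fin.sum_univ_succ] using congrFun hv i
    have hUv : ∀ k, U.mulVec x k * v 0 = 0 := fun k => by
      have := congrFun (congrArg U.mulVec hv) k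
      rw [Matrix.mulVec_mulVec, Matrix.mulVec_zero, Matrix.mulVec, dotProduct,
        Fin.sum_univ_succ] at this
      simp only [mul_of_insertNth, hUW] at this
      simpa using this
    have hv0 : v 0 = 0 := by
      by_contra hne
      have : ∀ k, U.mulVec x k = 0 := fun k => (mul_eq_zero.1 (hUv k)).resolve_right hne
      simp [this] at hx
    have hvs := hW (fun j => v j.succ) (by
      ext i
      simpa [hv0, Matrix.mulVec, dotProduct] using hv' i)
    ext j
    refine Fin.cases hv0 (fun j => congrFun hvs j) j

lemma memLp_olsMatrix {n d : ℕ} (h : d + 2 ≤ n) (a : Fin d) (i : Fin n) :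
    MemLp (fun X => olsMatrix (Matrix.of X) a i) 2 (gaussianMatrix n d) := by
  rw [memLp_two_iff_integrable_sq (measurable_olsMatrix a i).aestronglyMeasurable]
  refine ⟨((measurable_olsMatrix a i).pow_const 2).aestronglyMeasurable, ?_⟩
  rw [hasFiniteIntegral_iff_ofReal (ae_of_all _ fun _ => sq_nonneg _)]
  exact lintegral_olsMatrix_sq_lt_top h a i

lemma integrable_olsMatrix_mul_entry {n d : ℕ} (h : d + 2 ≤ n) (a : Fin d) (i j : Fin n)
    (b : Fin d) :
    Integrable (fun X => olsMatrix (Matrix.of X) a i * X j b) (gaussianMatrix n d) := by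
  have hmp : MeasurePreserving (fun X : Fin n → Fin d → ℝ => X j b) (gaussianMatrix n d)
      (gaussianReal 0 1) :=
    (measurePreserving_eval (fun _ : Fin d => gaussianReal 0 1) b).comp
      (measurePreserving_eval
        (fun _ : Fin n => Measure.pi fun _ : Fin d => gaussianReal 0 1) j)
  exact (memLp_olsMatrix h a i).integrable_mul
    (IsGaussian.memLp_two_id.comp_measurePreserving hmp)

lemma olsMatrix_diagonal_mul {n d : ℕ} (s : Fin n → ℝ) (hs : ∀ i, s i * s i = 1)
    (X : Matrix (Fin n) (Fin d) ℝ) (a : Fin d) (i : Fin n) :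
    olsMatrix (Matrix.diagonal s * X) a i = s i * olsMatrix X a i := by
  have hD : Matrix.diagonal s * Matrix.diagonal s = 1 := by
    rw [Matrix.diagonal_mul_diagonal, ← Matrix.diagonal_one]
    exact congrArg _ (funext hs)
  have hG : (Matrix.diagonal s * X)ᵀ * (Matrix.diagonal s * X) = Xᵀ * X := by
    rw [Matrix.transpose_mul, Matrix.diagonal_transpose, Matrix.mul_assoc,
      ← Matrix.mul_assoc (Matrix.diagonal s), hD, Matrix.one_mul]
  rw [olsMatrix, hG, Matrix.transpose_mul, Matrix.diagonal_transpose, ← Matrix.mul_assoc,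
    Matrix.mul_diagonal, mul_comm, olsMatrix]

lemma olsMatrix_submatrix {n d : ℕ} (σ : Equiv.Perm (Fin n)) (X : Matrix (Fin n) (Fin d) ℝ)
    (a : Fin d) (i : Fin n) :
    olsMatrix (X.submatrix σ id) a i = olsMatrix X a (σ i) := by
  have hG : (X.submatrix σ id)ᵀ * X.submatrix σ id = Xᵀ * X := by
    rw [Matrix.transpose_submatrix, Matrix.submatrix_mul_equiv, Matrix.submatrix_id_id]
  rw [olsMatrix, hG, olsMatrix, Matrix.mul_apply, Matrix.mul_apply]
  rfl

lemma integral_olsMatrix_mul_entry_of_ne {n d : ℕ} (a : Fin d) {i j : Fin n} (hij : i ≠ j)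
    (b : Fin d) :
    ∫ X, olsMatrix (Matrix.of X) a i * X j b ∂(gaussianMatrix n d) = 0 := by
  let s : Fin n → ℝ := fun l => if l = j then -1 else 1
  have hs : ∀ l, s l * s l = 1 := fun l => by by_cases hl : l = j <;> simp [s, hl]
  have hneg : MeasurePreserving (fun x : ℝ => -x) (gaussianReal 0 1) (gaussianReal 0 1) :=
    ⟨by fun_prop, by simp [gaussianReal_map_neg]⟩
  have hsmul : ∀ l, MeasurePreserving (fun x : ℝ => s l * x) (gaussianReal 0 1)
      (gaussianReal 0 1) := fun l => by
    by_cases hl : l = j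
    · simpa [s, hl] using hneg
    · simpa [s, hl] using! MeasurePreserving.id (gaussianReal 0 1)
  have hmp : MeasurePreserving (fun (X : Fin n → Fin d → ℝ) l c => s l * X l c)
      (gaussianMatrix n d) (gaussianMatrix n d) :=
    measurePreserving_pi _ _ (f := fun l (x : Fin d → ℝ) c => s l * x c) fun l =>
      measurePreserving_pi _ _ (f := fun _ x => s l * x) fun _ => hsmul l
  have hm : Measurable fun X : Fin n → Fin d → ℝ => olsMatrix (Matrix.of X) a i * X j b :=
    (measurable_olsMatrix a i).mul (by fun_prop)
  have key : ∫ X, olsMatrix (Matrix.of X) a i * X j b ∂(gaussianMatrix n d)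
      = -∫ X, olsMatrix (Matrix.of X) a i * X j b ∂(gaussianMatrix n d) := by
    conv_lhs => rw [← hmp.map_eq]
    rw [integral_map hmp.measurable.aemeasurable hm.aestronglyMeasurable, ← integral_neg]
    refine integral_congr_ae (ae_of_all _ fun X => ?_)
    have hX : (Matrix.of fun l c => s l * X l c) = Matrix.diagonal s * Matrix.of X := by
      ext l c
      simp [Matrix.diagonal_mul]
    simp only [hX, olsMatrix_diagonal_mul s hs]
    simp [s, hij]
  linarith

lemma integral_olsMatrix_mul_entry_self {n d : ℕ} (h : d + 2 ≤ n) (a : Fin d) (i : Fin n)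
    (b : Fin d) :
    ∫ X, olsMatrix (Matrix.of X) a i * X i b ∂(gaussianMatrix n d)
      = if a = b then (n : ℝ)⁻¹ else 0 := by
  have hsymm : ∀ j, ∫ X, olsMatrix (Matrix.of X) a j * X j b ∂(gaussianMatrix n d)
      = ∫ X, olsMatrix (Matrix.of X) a i * X i b ∂(gaussianMatrix n d) := by
    intro j
    let σ := Equiv.swap i j
    have hmp : MeasurePreserving (fun (X : Fin n → Fin d → ℝ) l => X (σ l))
        (gaussianMatrix n d) (gaussianMatrix n d) :=
      (measurePreserving_piCongrLeft (α := fun _ : Fin n => Fin d → ℝ)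
        (fun _ => Measure.pi fun _ : Fin d => gaussianReal 0 1) σ).symm
    have hm : Measurable fun X : Fin n → Fin d → ℝ => olsMatrix (Matrix.of X) a i * X i b :=
      (measurable_olsMatrix a i).mul (by fun_prop)
    conv_rhs => rw [← hmp.map_eq]
    rw [integral_map hmp.measurable.aemeasurable hm.aestronglyMeasurable]
    refine integral_congr_ae (ae_of_all _ fun X => ?_)
    have hX : (Matrix.of fun l => X (σ l)) = (Matrix.of X).submatrix σ id := rfl
    simp only [hX, olsMatrix_submatrix]
    simp [σ]
  have hsum : ∑ j, ∫ X, olsMatrix (Matrix.of X) a j * X j b ∂(gaussianMatrix n d)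
      = if a = b then 1 else 0 := by
    rw [← integral_finsetSum _ fun j _ => integrable_olsMatrix_mul_entry h a j j b]
    calc _ = ∫ _, (if a = b then (1 : ℝ) else 0) ∂(gaussianMatrix n d) := by
          refine integral_congr_ae ?_
          filter_upwards [ae_det_gram_ne_zero h] with X hX
          rw [← Matrix.one_apply, ← olsMatrix_mul_self hX, Matrix.mul_apply]
          rfl
      _ = _ := by simp
  rw [Finset.sum_congr rfl fun j _ => hsymm j, Finset.sum_const, Finset.card_univ,
    Fintype.card_fin, nsmul_eq_mul] at hsum
  have hn : (n : ℝ) ≠ 0 := by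
    have : n ≠ 0 := by omega
    exact_mod_cast this
  split_ifs at hsum ⊢ with hab
  · field_simp
    linarith
  · exact (mul_eq_zero.1 hsum).resolve_left hn

lemma sum_fixed_of_mem_movesExactly {n k : ℕ} {σ : Equiv.Perm (Fin n)}
    (hσ : σ ∈ movesExactly n k) :
    ∑ i, (if σ i = i then (1 : ℝ) else 0) = n - k := by
  have hk : (Finset.univ.filter fun i => σ i ≠ i).card = k := (Finset.mem_filter.1 hσ).2
  have := Finset.card_filter_add_card_filter_not (s := (Finset.univ : Finset (Fin n)))
    (fun i => σ i = i)
  rw [Finset.card_univ, Fintype.card_fin] at this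
  rw [Finset.sum_boole, ← hk, eq_sub_iff_add_eq]
  exact_mod_cast this

/-- in the shuffled linear model `y = Π* X β* + σ* ε` with `X` an
`n×d` matrix of independent `N(0,1)` entries, `ε` i.i.d. `N(0,1)`, and `π*`
uniform on the permutations moving exactly `k` indices (all jointly
independent), the OLS estimator `β̂^LS = (XᵀX)⁻¹Xᵀy` satisfies
`E[β̂^LS] = (1 − α*) β*` with `α* = k/n`. -/
theorem ols_expectation_shuffled (n d k : ℕ) (hnd : d + 2 ≤ n) (hd : 1 ≤ d)
    (hk2 : 2 ≤ k) (hkn : k ≤ n)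
    (β : Fin d → ℝ) (σ : ℝ) (hσ : 0 < σ)
    (Ω : Type*) [MeasureSpace Ω] [IsProbabilityMeasure (ℙ : Measure Ω)]
    (X : Ω → Fin n → Fin d → ℝ) (ε : Ω → Fin n → ℝ) (π : Ω → Equiv.Perm (Fin n))
    (hXm : Measurable X) (hεm : Measurable ε) (hπm : Measurable π)
    -- the entries of X are independent N(0,1)
    (hX : Measure.map X ℙ
      = Measure.pi fun _ : Fin n => Measure.pi fun _ : Fin d => gaussianReal 0 1)
    -- the entries of ε are i.i.d. N(0,1)
    (hε : Measure.map ε ℙ = Measure.pi fun _ : Fin n => gaussianReal 0 1)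
    -- π* is uniform on the permutations moving exactly k indices
    (hπ : ∀ σ' : Equiv.Perm (Fin n), ℙ {ω | π ω = σ'} =
      if σ' ∈ movesExactly n k then ((movesExactly n k).card : ℝ≥0∞)⁻¹ else 0)
    -- X, ε, π* are jointly independent
    (hindep1 : IndepFun X (fun ω => (ε ω, π ω)) ℙ)
    (hindep2 : IndepFun ε π ℙ)
    (y : Ω → Fin n → ℝ)
    (hy : y = fun ω =>
      (Equiv.Perm.permMatrix ℝ (π ω) * Matrix.of (X ω)).mulVec β + σ • ε ω)
    (βLS : Ω → Fin d → ℝ)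
    (hβLS : βLS = fun ω =>
      (((Matrix.of (X ω))ᵀ * Matrix.of (X ω))⁻¹ * (Matrix.of (X ω))ᵀ).mulVec (y ω)) :
    Integrable βLS ℙ ∧ ∫ ω, βLS ω ∂ℙ = (1 - (k : ℝ) / n) • β := by
  have hXlaw : MeasurePreserving X ℙ (gaussianMatrix n d) := ⟨hXm, hX⟩
  have hεlaw : MeasurePreserving ε ℙ (Measure.pi fun _ : Fin n => gaussianReal 0 1) := ⟨hεm, hε⟩
  have hXε : IndepFun X ε ℙ := hindep1.comp measurable_id measurable_fst
  have hXπ : IndepFun X π ℙ := hindep1.comp measurable_id measurable_snd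
  have hmA : ∀ a i, Measurable fun X : Fin n → Fin d → ℝ => olsMatrix (Matrix.of X) a i :=
    fun a i => measurable_olsMatrix a i
  have hmAX : ∀ a i j b, Measurable fun X : Fin n → Fin d → ℝ =>
      olsMatrix (Matrix.of X) a i * X j b := fun a i j b => (hmA a i).mul (by fun_prop)
  have hmI : ∀ i j, Measurable fun τ : Equiv.Perm (Fin n) => if τ i = j then (1 : ℝ) else 0 :=
    fun i j _ _ => trivial
  -- the noise contribution
  have hindN : ∀ a i, IndepFun (fun ω => olsMatrix (Matrix.of (X ω)) a i) (fun ω => ε ω i) ℙ :=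
    fun a i => hXε.comp (hmA a i) (measurable_pi_apply i)
  have hεi : ∀ i, MeasurePreserving (fun ω => ε ω i) ℙ (gaussianReal 0 1) := fun i =>
    (measurePreserving_eval (fun _ : Fin n => gaussianReal 0 1) i).comp hεlaw
  have hintε : ∀ i, Integrable (fun ω => ε ω i) ℙ := fun i =>
    (hεi i).integrable_comp_of_integrable IsGaussian.integrable_id
  have hintA : ∀ a i, Integrable (fun ω => olsMatrix (Matrix.of (X ω)) a i) ℙ := fun a i =>
    hXlaw.integrable_comp_of_integrable ((memLp_olsMatrix hnd a i).integrable one_le_two)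
  have hN : ∀ a i, Integrable (fun ω => olsMatrix (Matrix.of (X ω)) a i * ε ω i) ℙ :=
    fun a i => (hindN a i).integrable_mul (hintA a i) (hintε i)
  have hN0 : ∀ a i, ∫ ω, olsMatrix (Matrix.of (X ω)) a i * ε ω i = 0 := fun a i => by
    have h0 : ∫ ω, ε ω i = 0 := by
      have := integral_map (μ := ℙ) (hεi i).measurable.aemeasurable
        (f := fun x : ℝ => x) (by fun_prop)
      rw [← this, (hεi i).map_eq, integral_id_gaussianReal]
    rw [(hindN a i).integral_fun_mul_eq_mul_integral (hintA a i).aestronglyMeasurable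
      (hintε i).aestronglyMeasurable, h0, mul_zero]
  -- the signal contribution
  have hindS : ∀ a i j b, IndepFun (fun ω => olsMatrix (Matrix.of (X ω)) a i * X ω j b)
      (fun ω => if π ω i = j then (1 : ℝ) else 0) ℙ :=
    fun a i j b => hXπ.comp (hmAX a i j b) (hmI i j)
  have hintAX : ∀ a i j b, Integrable (fun ω => olsMatrix (Matrix.of (X ω)) a i * X ω j b) ℙ :=
    fun a i j b =>
      hXlaw.integrable_comp_of_integrable (integrable_olsMatrix_mul_entry hnd a i j b)
  have hintI : ∀ i j, Integrable (fun ω => if π ω i = j then (1 : ℝ) else 0) ℙ := fun i j =>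
    Integrable.of_bound ((hmI i j).comp hπm).aestronglyMeasurable 1
      (ae_of_all _ fun ω => by
        show ‖if π ω i = j then (1 : ℝ) else 0‖ ≤ 1
        split_ifs <;> simp)
  have hS : ∀ a i j b, Integrable (fun ω => olsMatrix (Matrix.of (X ω)) a i * X ω j b *
      if π ω i = j then (1 : ℝ) else 0) ℙ :=
    fun a i j b => (hindS a i j b).integrable_mul (hintAX a i j b) (hintI i j)
  have hSval : ∀ a i j b, ∫ ω, olsMatrix (Matrix.of (X ω)) a i * X ω j b *
      (if π ω i = j then (1 : ℝ) else 0)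
      = if i = j then (if a = b then (n : ℝ)⁻¹ else 0) * ∫ ω, (if π ω i = i then (1 : ℝ) else 0)
        else 0 := fun a i j b => by
    have hX' : ∫ ω, olsMatrix (Matrix.of (X ω)) a i * X ω j b
        = ∫ X, olsMatrix (Matrix.of X) a i * X j b ∂(gaussianMatrix n d) := by
      rw [← hXlaw.map_eq, integral_map hXm.aemeasurable (hmAX a i j b).aestronglyMeasurable]
    rw [(hindS a i j b).integral_fun_mul_eq_mul_integral (hintAX a i j b).aestronglyMeasurable
      (hintI i j).aestronglyMeasurable, hX']
    split_ifs with hij hab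
    · subst hij hab
      rw [integral_olsMatrix_mul_entry_self hnd, if_pos rfl]
    · subst hij
      rw [integral_olsMatrix_mul_entry_self hnd, if_neg hab]
    · rw [integral_olsMatrix_mul_entry_of_ne a hij, zero_mul]
  have hfix : ∑ i, ∫ ω, (if π ω i = i then (1 : ℝ) else 0) = n - k := by
    rw [← integral_finsetSum _ fun i _ => hintI i i]
    have hmem : ∀ᵐ ω, π ω ∈ movesExactly n k := by
      have : ∀ᵐ ω, ∀ τ : Equiv.Perm (Fin n), τ ∉ movesExactly n k → π ω ≠ τ := by
        refine ae_all_iff.2 fun τ => ?_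
        by_cases hτ : τ ∈ movesExactly n k
        · exact ae_of_all _ fun ω h => absurd hτ h
        · have h0 := hπ τ
          rw [if_neg hτ] at h0
          have : ∀ᵐ ω, π ω ≠ τ := by
            rw [ae_iff]
            simpa using h0
          filter_upwards [this] with ω hω _ using hω
      filter_upwards [this] with ω hω
      by_contra hne
      exact hω _ hne rfl
    calc _ = ∫ _ : Ω, ((n : ℝ) - k) := by
          refine integral_congr_ae ?_
          filter_upwards [hmem] with ω hω using sum_fixed_of_mem_movesExactly hω
      _ = _ := by simp
  -- expansion of the estimator
  have hexp : ∀ ω a, βLS ω a = ∑ i, ∑ j, ∑ b, (olsMatrix (Matrix.of (X ω)) a i * X ω j b *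
      (if π ω i = j then (1 : ℝ) else 0)) * β b
      + ∑ i, (olsMatrix (Matrix.of (X ω)) a i * ε ω i) * σ := fun ω a => by
    rw [hβLS, hy, ← Finset.sum_add_distrib]
    change ∑ i, olsMatrix (Matrix.of (X ω)) a i *
      ((Equiv.Perm.permMatrix ℝ (π ω) * Matrix.of (X ω)).mulVec β + σ • ε ω) i = _
    refine Finset.sum_congr rfl fun i _ => ?_
    have h1 : (Equiv.Perm.permMatrix ℝ (π ω) * Matrix.of (X ω)).mulVec β i
        = ∑ b, X ω (π ω i) b * β b := by
      rw [← Matrix.mulVec_mulVec, Matrix.permMatrix_mulVec]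
      rfl
    have h2 : ∑ j, ∑ b, (olsMatrix (Matrix.of (X ω)) a i * X ω j b *
        (if π ω i = j then (1 : ℝ) else 0)) * β b
        = olsMatrix (Matrix.of (X ω)) a i * ∑ b, X ω (π ω i) b * β b := by
      rw [Finset.sum_eq_single (π ω i) (fun j _ hj => by simp [hj.symm]) (by simp),
        Finset.mul_sum]
      exact Finset.sum_congr rfl fun b _ => by simp [mul_assoc]
    rw [h2, Pi.add_apply, h1, Pi.smul_apply, smul_eq_mul]
    ring
  have hS1 : ∀ a i j, Integrable (fun ω => ∑ b, (olsMatrix (Matrix.of (X ω)) a i * X ω j b *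
      (if π ω i = j then (1 : ℝ) else 0)) * β b) ℙ := fun a i j =>
    integrable_finsetSum _ fun b _ => (hS a i j b).mul_const _
  have hS2 : ∀ a i, Integrable (fun ω => ∑ j, ∑ b, (olsMatrix (Matrix.of (X ω)) a i * X ω j b *
      (if π ω i = j then (1 : ℝ) else 0)) * β b) ℙ := fun a i =>
    integrable_finsetSum _ fun j _ => hS1 a i j
  have hS3 : ∀ a, Integrable (fun ω => ∑ i, ∑ j, ∑ b, (olsMatrix (Matrix.of (X ω)) a i *
      X ω j b * (if π ω i = j then (1 : ℝ) else 0)) * β b) ℙ := fun a =>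
    integrable_finsetSum _ fun i _ => hS2 a i
  have hN1 : ∀ a, Integrable (fun ω => ∑ i, (olsMatrix (Matrix.of (X ω)) a i * ε ω i) * σ) ℙ :=
    fun a => integrable_finsetSum _ fun i _ => (hN a i).mul_const _
  have hint : ∀ a, Integrable (fun ω => βLS ω a) ℙ := fun a => by
    simp_rw [hexp]
    exact (hS3 a).add (hN1 a)
  refine ⟨Integrable.of_eval hint, funext fun a => ?_⟩
  have hn : (n : ℝ) ≠ 0 := by
    have : n ≠ 0 := by omega
    exact_mod_cast this
  have hsig : ∫ ω, ∑ i, ∑ j, ∑ b, (olsMatrix (Matrix.of (X ω)) a i * X ω j b *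
      (if π ω i = j then (1 : ℝ) else 0)) * β b = (1 - (k : ℝ) / n) * β a := by
    rw [integral_finsetSum _ fun i _ => hS2 a i]
    calc _ = ∑ i : Fin n, (n : ℝ)⁻¹ * (∫ ω, (if π ω i = i then (1 : ℝ) else 0)) * β a := by
          refine Finset.sum_congr rfl fun i _ => ?_
          rw [integral_finsetSum _ fun j _ => hS1 a i j]
          simp_rw [integral_finsetSum _ fun b _ => (hS a i _ b).mul_const _, integral_mul_const,
            hSval]
          simp [ite_mul]
      _ = (1 - (k : ℝ) / n) * β a := by
          rw [← Finset.sum_mul, ← Finset.mul_sum, hfix]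
          field_simp
  have hnoise : ∫ ω, ∑ i, (olsMatrix (Matrix.of (X ω)) a i * ε ω i) * σ = 0 := by
    rw [integral_finsetSum _ fun i _ => (hN a i).mul_const _]
    simp [integral_mul_const, hN0]
  rw [eval_integral hint]
  simp_rw [hexp]
  rw [integral_add (hS3 a) (hN1 a), hsig, hnoise, add_zero, Pi.smul_apply, smul_eq_mul]
end

section
/- Let n ≥ 2 and 2 ≤ k ≤ n. Let X be an n×d random matrix with independent N(0,1) entries and rows x₁ᵀ,…,xₙᵀ, let ε ∈ ℝⁿ have i.i.d. N(0,1) entries, and let π* be uniform on the permutations of {1,…,n} moving exactly k indices, with X, ε, π* jointly independent. Set yᵢ = x_{π*(i)}ᵀ β* + σ* εᵢ for β* ∈ ℝ^d and σ* > 0, and α* = k/n. Then for every i, the expectation over X of the conditional variance of yᵢ given X equals E_X[Var(yᵢ | X)] = α*(1−α*)‖β*‖₂² + α*‖β*‖₂² − (α*²/(n−1))‖β*‖₂² + σ*². -/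
open MeasureTheory ProbabilityTheory Matrix
open scoped BigOperators ENNReal

open Finset in
/-- A probability vector on permutations that is constant on conjugacy classes and supported on
the permutations moving exactly `k` indices sends `i` to itself with probability `1 - k / n`, and
to any other given index with probability `k / n / (n - 1)`. -/
theorem sum_classFunction_apply_eq {n k : ℕ} (hn : 2 ≤ n) (q : Equiv.Perm (Fin n) → ℝ)
    (hconj : ∀ τ ρ, q (τ * ρ * τ⁻¹) = q ρ) (hsum : ∑ ρ, q ρ = 1)
    (hk : ∀ ρ, q ρ ≠ 0 → (univ.filter fun i => ρ i ≠ i).card = k) (i j : Fin n) :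
    ∑ ρ, (if ρ i = j then q ρ else 0)
      = if j = i then 1 - (k : ℝ) / n else (k : ℝ) / n / (n - 1) := by
  set p : Fin n → Fin n → ℝ := fun i j => ∑ ρ, (if ρ i = j then q ρ else 0) with hp
  have hn0 : (n : ℝ) ≠ 0 := by positivity
  have hn1 : (n : ℝ) - 1 ≠ 0 := by
    have : (2 : ℝ) ≤ n := by exact_mod_cast hn
    linarith
  have hpc : ∀ (τ : Equiv.Perm (Fin n)) a b, p (τ a) (τ b) = p a b := by
    intro τ a b
    simp only [hp]
    rw [← Equiv.sum_comp (MulAut.conj τ).toEquiv]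
    refine Finset.sum_congr rfl fun ρ _ => ?_
    simp [MulAut.conj_apply, hconj]
  have hrow : ∀ a, ∑ b, p a b = 1 := by
    intro a
    simp only [hp]
    rw [Finset.sum_comm]
    simpa using hsum
  have htr : ∑ a, p a a = n - k := by
    simp only [hp]
    rw [Finset.sum_comm]
    have : ∀ ρ : Equiv.Perm (Fin n), ∑ a, (if ρ a = a then q ρ else 0) = (n - k) * q ρ := by
      intro ρ
      by_cases h : q ρ = 0
      · simp [h]
      · have h1 := hk ρ h
        have h2 := Finset.card_filter_add_card_filter_not (s := univ) (fun a => ρ a = a)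
        rw [← Finset.sum_filter, Finset.sum_const, nsmul_eq_mul]
        congr 1
        have h3 : ((univ.filter fun a => ρ a = a).card : ℝ) + k = n := by
          rw [← h1]; exact_mod_cast (by simpa using h2)
        linarith
    simp_rw [this]
    rw [← Finset.mul_sum, hsum, mul_one]
  have hdiag : p i i = 1 - (k : ℝ) / n := by
    have h : ∀ a, p a a = p i i := fun a => by
      have := hpc (Equiv.swap i a) i i
      simpa using this
    rw [Finset.sum_congr rfl fun a _ => h a] at htr
    simp at htr
    field_simp
    linarith
  split_ifs with hij
  · rw [hij]; exact hdiag
  · have h : ∀ b ∈ univ.erase i, p i b = p i j := fun b hb => by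
      have := hpc (Equiv.swap j b) i j
      rw [Equiv.swap_apply_of_ne_of_ne (Ne.symm hij) (Ne.symm (Finset.ne_of_mem_erase hb))] at this
      simpa using this
    have h2 := hrow i
    rw [← Finset.add_sum_erase _ _ (Finset.mem_univ i), Finset.sum_congr rfl h, hdiag] at h2
    simp only [sum_const, card_erase_of_mem (mem_univ i), card_univ, Fintype.card_fin,
      nsmul_eq_mul] at h2
    rw [Nat.cast_sub (by omega)] at h2
    change p i j = _
    rw [eq_div_iff hn1]
    push_cast at h2
    linarith

section PiMoments

variable {ι : Type*} [Fintype ι] {S : ι → Type*} {mS : ∀ i, MeasurableSpace (S i)}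
  {μ : ∀ i, Measure (S i)} [∀ i, IsProbabilityMeasure (μ i)] {f : ∀ i, S i → ℝ}

theorem memLp_two_sum_pi (hf : ∀ i, MemLp (f i) 2 (μ i)) :
    MemLp (fun x => ∑ i, f i (x i)) 2 (Measure.pi μ) :=
  memLp_finsetSum _ fun i _ => (hf i).comp_measurePreserving (measurePreserving_eval μ i)

theorem integral_sum_pi_eq_zero (hf : ∀ i, MemLp (f i) 2 (μ i)) (h0 : ∀ i, ∫ s, f i s ∂μ i = 0) :
    ∫ x, ∑ i, f i (x i) ∂Measure.pi μ = 0 := by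
  rw [integral_finsetSum]
  · exact Finset.sum_eq_zero fun i _ => by
      rw [integral_comp_eval (hf i).aestronglyMeasurable, h0]
  · exact fun i _ => ((hf i).comp_measurePreserving (measurePreserving_eval μ i)).integrable
      one_le_two

theorem integral_sum_pi_sq (hf : ∀ i, MemLp (f i) 2 (μ i)) (h0 : ∀ i, ∫ s, f i s ∂μ i = 0) :
    ∫ x, (∑ i, f i (x i)) ^ 2 ∂Measure.pi μ = ∑ i, ∫ s, f i s ^ 2 ∂μ i := by
  rw [← variance_of_integral_eq_zero (memLp_two_sum_pi hf).aestronglyMeasurable.aemeasurable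
    (integral_sum_pi_eq_zero hf h0)]
  have h := variance_sum_pi hf
  rw [Finset.sum_fn] at h
  rw [h]
  exact Finset.sum_congr rfl fun i _ =>
    variance_of_integral_eq_zero (hf i).aestronglyMeasurable.aemeasurable (h0 i)

end PiMoments

theorem integral_sq_gaussianReal_zero_one : ∫ x, x ^ 2 ∂gaussianReal 0 1 = 1 := by
  have h := variance_of_integral_eq_zero (X := id) (μ := gaussianReal 0 1) aemeasurable_id
    (by simp)
  rw [variance_id_gaussianReal] at h
  simpa using h.symm

section GaussianLinear

variable {d : ℕ} (β : Fin d → ℝ)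

theorem memLp_two_gaussian_mul_const (c : ℝ) :
    MemLp (fun x : ℝ => x * c) 2 (gaussianReal 0 1) :=
  (memLp_id_gaussianReal' 2 (by simp)).mul_const c

theorem integral_gaussian_mul_const (c : ℝ) : ∫ x, x * c ∂gaussianReal 0 1 = 0 := by
  rw [integral_mul_const]; simp

theorem memLp_two_gaussian_linear :
    MemLp (fun v : Fin d → ℝ => ∑ l, v l * β l) 2 (Measure.pi fun _ => gaussianReal 0 1) :=
  memLp_two_sum_pi (f := fun l x => x * β l) fun l => memLp_two_gaussian_mul_const (β l)

theorem integral_gaussian_linear :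
    ∫ v : Fin d → ℝ, ∑ l, v l * β l ∂(Measure.pi fun _ => gaussianReal 0 1) = 0 :=
  integral_sum_pi_eq_zero (f := fun l x => x * β l)
    (fun l => memLp_two_gaussian_mul_const (β l)) fun l => integral_gaussian_mul_const (β l)

theorem integral_gaussian_linear_sq :
    ∫ v : Fin d → ℝ, (∑ l, v l * β l) ^ 2 ∂(Measure.pi fun _ => gaussianReal 0 1)
      = ∑ l, β l ^ 2 := by
  rw [integral_sum_pi_sq (f := fun l x => x * β l)
    (fun l => memLp_two_gaussian_mul_const (β l)) fun l => integral_gaussian_mul_const (β l)]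
  refine Finset.sum_congr rfl fun l _ => ?_
  simp_rw [mul_pow]
  rw [integral_mul_const, integral_sq_gaussianReal_zero_one, one_mul]

/-- Second moment of a linear combination of the independent variables `xⱼᵀβ`. -/
theorem integral_sum_mul_gaussian_linear_sq {n : ℕ} (p : Fin n → ℝ) :
    ∫ x : Fin n → Fin d → ℝ, (∑ j, (∑ l, x j l * β l) * p j) ^ 2
        ∂(Measure.pi fun _ => Measure.pi fun _ => gaussianReal 0 1)
      = ∑ j, p j ^ 2 * ∑ l, β l ^ 2 := by
  rw [integral_sum_pi_sq (f := fun j (v : Fin d → ℝ) => (∑ l, v l * β l) * p j)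
    (fun j => (memLp_two_gaussian_linear β).mul_const (p j))
    fun j => by rw [integral_mul_const, integral_gaussian_linear, zero_mul]]
  refine Finset.sum_congr rfl fun j _ => ?_
  simp_rw [mul_pow]
  rw [integral_mul_const, integral_gaussian_linear_sq, mul_comm]

end GaussianLinear

/-- If `(e, s)` is independent of `X`, `e` is centred and `s` takes finitely many values with
probabilities `p`, then `∑ j, gⱼ(X) 1{s = j} + σ e` has expected conditional variance
`∑ j, p j E[gⱼ(X)²] + σ² E[e²] - E[(∑ j, p j gⱼ(X))²]`. -/
theorem integral_condVar_mixture {Ω S ι : Type*} [MeasurableSpace Ω] {μ : Measure Ω}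
    [IsProbabilityMeasure μ] [mS : MeasurableSpace S] [Fintype ι] [DecidableEq ι]
    [MeasurableSpace ι] [MeasurableSingletonClass ι]
    {X : Ω → S} {e : Ω → ℝ} {s : Ω → ι} (hX : Measurable X) (he : Measurable e)
    (hs : Measurable s) (hind : IndepFun X (fun ω => (e ω, s ω)) μ)
    (he2 : MemLp e 2 μ) (he0 : ∫ ω, e ω ∂μ = 0)
    {g : ι → S → ℝ} (hg : ∀ j, Measurable (g j)) (hg2 : ∀ j, MemLp (fun ω => g j (X ω)) 2 μ)
    (hg0 : ∀ j, ∫ ω, g j (X ω) ∂μ = 0) (σ : ℝ) (p : ι → ℝ)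
    (hp : ∀ j, ∫ ω, (if s ω = j then (1 : ℝ) else 0) ∂μ = p j) :
    ∫ ω, ((μ[fun ω' => (g (s ω') (X ω') + σ * e ω') ^ 2 | mS.comap X]) ω
          - ((μ[fun ω' => g (s ω') (X ω') + σ * e ω' | mS.comap X]) ω) ^ 2) ∂μ
      = ∑ j, (∫ ω, g j (X ω) ^ 2 ∂μ) * p j + σ ^ 2 * ∫ ω, e ω ^ 2 ∂μ
        - ∫ ω, (∑ j, g j (X ω) * p j) ^ 2 ∂μ := by
  have hle : mS.comap X ≤ ‹MeasurableSpace Ω› := hX.comap_le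
  set I : ι → Ω → ℝ := fun j ω => if s ω = j then 1 else 0 with hI
  have hφ : ∀ j, Measurable fun z : ℝ × ι => if z.2 = j then (1 : ℝ) else 0 := fun j =>
    Measurable.ite (measurable_snd (measurableSet_singleton j)) measurable_const measurable_const
  have hIm : ∀ j, Measurable (I j) := fun j => (hφ j).comp (he.prodMk hs)
  have hIb : ∀ j, ∀ᵐ ω ∂μ, ‖I j ω‖ ≤ 1 := fun j => ae_of_all _ fun ω => by
    simp only [hI]; split_ifs <;> simp
  have hIint : ∀ j, Integrable (I j) μ := fun j =>
    Integrable.of_bound (hIm j).aestronglyMeasurable 1 (hIb j)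
  have heint : Integrable e μ := he2.integrable one_le_two
  have heI : ∀ j, Integrable (fun ω => e ω * I j ω) μ := fun j =>
    heint.mul_bdd (hIm j).aestronglyMeasurable (hIb j)
  have hgint : ∀ j, Integrable (fun ω => g j (X ω)) μ := fun j => (hg2 j).integrable one_le_two
  have hgI : ∀ j, IndepFun (fun ω => g j (X ω)) (I j) μ := fun j => hind.comp (hg j) (hφ j)
  have hg2I : ∀ j, IndepFun (fun ω => g j (X ω) ^ 2) (I j) μ := fun j =>
    hind.comp ((hg j).pow_const 2) (hφ j)
  have hgeI : ∀ j, IndepFun (fun ω => g j (X ω)) (fun ω => e ω * I j ω) μ := fun j =>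
    hind.comp (hg j) (measurable_fst.mul (hφ j))
  have hgIint : ∀ j, Integrable (fun ω => g j (X ω) * I j ω) μ := fun j =>
    (hgI j).integrable_mul (hgint j) (hIint j)
  have hg2Iint : ∀ j, Integrable (fun ω => g j (X ω) ^ 2 * I j ω) μ := fun j =>
    (hg2I j).integrable_mul (hg2 j).integrable_sq (hIint j)
  have hgeIint : ∀ j, Integrable (fun ω => g j (X ω) * (e ω * I j ω)) μ := fun j =>
    (hgeI j).integrable_mul (hgint j) (heI j)
  -- the conditional mean
  have hIcond : ∀ j, μ[I j | mS.comap X] =ᵐ[μ] fun _ => p j := fun j => by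
    have h : Indep (MeasurableSpace.comap (I j) inferInstance) (mS.comap X) μ :=
      (hind.comp measurable_id (hφ j)).symm
    have h1 := condExp_indep_eq (hIm j).comap_le hle (comap_measurable (I j)).stronglyMeasurable h
    rwa [hp j] at h1
  have hecond : μ[e | mS.comap X] =ᵐ[μ] fun _ => 0 := by
    have h : Indep (MeasurableSpace.comap e inferInstance) (mS.comap X) μ :=
      (hind.comp measurable_id measurable_fst).symm
    have h1 := condExp_indep_eq he.comap_le hle (comap_measurable e).stronglyMeasurable h
    rwa [he0] at h1
  have hgIcond : ∀ j, μ[fun ω => g j (X ω) * I j ω | mS.comap X]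
      =ᵐ[μ] fun ω => g j (X ω) * p j := fun j => by
    have hsm : StronglyMeasurable[mS.comap X] fun ω => g j (X ω) :=
      ((hg j).comp (comap_measurable X)).stronglyMeasurable
    filter_upwards [condExp_mul_of_stronglyMeasurable_left hsm (hgIint j) (hIint j), hIcond j]
      with ω h1 h2
    rw [← h2]; exact h1
  have hy : (fun ω => g (s ω) (X ω) + σ * e ω)
      = (∑ j, fun ω => g j (X ω) * I j ω) + σ • e := by
    ext ω
    simp [hI, Finset.sum_apply]
  have hmean : μ[fun ω => g (s ω) (X ω) + σ * e ω | mS.comap X]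
      =ᵐ[μ] fun ω => ∑ j, g j (X ω) * p j := by
    rw [hy]
    filter_upwards [condExp_add (integrable_finsetSum' _ fun j _ => hgIint j) (heint.smul σ)
        (mS.comap X), condExp_finsetSum (fun j (_ : j ∈ Finset.univ) => hgIint j) (mS.comap X),
      condExp_smul σ e (mS.comap X), hecond, ae_all_iff.2 hgIcond] with ω h1 h2 h3 h4 h5
    rw [h1, Pi.add_apply, h2, h3, Finset.sum_apply, Pi.smul_apply, h4, smul_zero, add_zero]
    exact Finset.sum_congr rfl fun j _ => h5 j
  -- the second moment
  have hy2 : (fun ω => (g (s ω) (X ω) + σ * e ω) ^ 2)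
      = fun ω => (∑ j, g j (X ω) ^ 2 * I j ω)
        + (2 * σ * ∑ j, g j (X ω) * (e ω * I j ω)) + σ ^ 2 * e ω ^ 2 := by
    ext ω
    simp only [hI, mul_ite, mul_one, mul_zero, Finset.sum_ite_eq, Finset.mem_univ, if_true]
    ring
  have hA := integrable_finsetSum Finset.univ fun j _ => hg2Iint j
  have hB := (integrable_finsetSum Finset.univ fun j _ => hgeIint j).const_mul (2 * σ)
  have hAB : Integrable (fun ω => (∑ j, g j (X ω) ^ 2 * I j ω)
      + 2 * σ * ∑ j, g j (X ω) * (e ω * I j ω)) μ := hA.add hB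
  have hC := he2.integrable_sq.const_mul (σ ^ 2)
  have hsecond : ∫ ω, (g (s ω) (X ω) + σ * e ω) ^ 2 ∂μ
      = ∑ j, (∫ ω, g j (X ω) ^ 2 ∂μ) * p j + σ ^ 2 * ∫ ω, e ω ^ 2 ∂μ := by
    rw [hy2, integral_add hAB hC, integral_add hA hB, integral_const_mul,
      integral_const_mul, integral_finsetSum _ fun j _ => hg2Iint j,
      integral_finsetSum _ fun j _ => hgeIint j]
    have h1 : ∀ j, ∫ ω, g j (X ω) ^ 2 * I j ω ∂μ = (∫ ω, g j (X ω) ^ 2 ∂μ) * p j := fun j => by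
      rw [(hg2I j).integral_fun_mul_eq_mul_integral (hg2 j).integrable_sq.aestronglyMeasurable
        (hIint j).aestronglyMeasurable, hp j]
    have h2 : ∀ j, ∫ ω, g j (X ω) * (e ω * I j ω) ∂μ = 0 := fun j => by
      rw [(hgeI j).integral_fun_mul_eq_mul_integral (hgint j).aestronglyMeasurable
        (heI j).aestronglyMeasurable, hg0 j, zero_mul]
    simp [h1, h2]
  have hmean2 : MemLp (fun ω => ∑ j, g j (X ω) * p j) 2 μ :=
    memLp_finsetSum _ fun j _ => (hg2 j).mul_const (p j)
  have hsq : (fun ω => ((μ[fun ω' => g (s ω') (X ω') + σ * e ω' | mS.comap X]) ω) ^ 2)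
      =ᵐ[μ] fun ω => (∑ j, g j (X ω) * p j) ^ 2 := by
    filter_upwards [hmean] with ω h
    rw [h]
  rw [integral_sub integrable_condExp (hmean2.integrable_sq.congr hsq.symm),
    integral_condExp hle, hsecond, integral_congr_ae hsq]

/-- Conjugation preserves the number of moved indices. -/
theorem conj_mem_movesExactly {n k : ℕ} (τ ρ : Equiv.Perm (Fin n)) :
    τ * ρ * τ⁻¹ ∈ movesExactly n k ↔ ρ ∈ movesExactly n k := by
  simp only [movesExactly, Finset.mem_filter, Finset.mem_univ, true_and]
  have h : (Finset.univ.filter fun i => (τ * ρ * τ⁻¹) i ≠ i).card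
      = (Finset.univ.filter fun i => ρ i ≠ i).card := by
    refine Finset.card_equiv τ⁻¹ fun i => ?_
    rw [Finset.mem_filter, Finset.mem_filter]
    simp only [Finset.mem_univ, true_and, Equiv.Perm.mul_apply, ne_eq, Equiv.Perm.eq_inv_iff_eq]
  rw [h]

/-- The law of `π i` when `π` is uniform on the permutations moving exactly `k` indices. -/
theorem integral_uniform_movesExactly_apply_eq {n k : ℕ} (hn : 2 ≤ n) {Ω : Type*}
    [MeasurableSpace Ω] {μ : Measure Ω} [IsProbabilityMeasure μ] {π : Ω → Equiv.Perm (Fin n)}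
    (hπm : Measurable π)
    (hπ : ∀ ρ : Equiv.Perm (Fin n), μ {ω | π ω = ρ} =
      if ρ ∈ movesExactly n k then ((movesExactly n k).card : ℝ≥0∞)⁻¹ else 0) (i j : Fin n) :
    ∫ ω, (if π ω i = j then (1 : ℝ) else 0) ∂μ
      = if j = i then 1 - (k : ℝ) / n else (k : ℝ) / n / (n - 1) := by
  have hms : ∀ ρ, MeasurableSet {ω | π ω = ρ} := fun ρ =>
    hπm (show MeasurableSet[⊤] {ρ} from trivial)
  have key : ∀ f : Equiv.Perm (Fin n) → ℝ,
      ∫ ω, f (π ω) ∂μ = ∑ ρ, f ρ * μ.real {ω | π ω = ρ} := fun f => by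
    have h : ∀ ω, f (π ω) = ∑ ρ, f ρ * {ω | π ω = ρ}.indicator (fun _ => (1 : ℝ)) ω := fun ω => by
      simp [Set.indicator_apply]
    simp_rw [h]
    rw [integral_finsetSum _ fun ρ _ =>
      ((integrable_const (1 : ℝ)).indicator (hms ρ)).const_mul (f ρ)]
    refine Finset.sum_congr rfl fun ρ _ => ?_
    rw [integral_const_mul, integral_indicator_const _ (hms ρ)]
    simp
  rw [← sum_classFunction_apply_eq hn (fun ρ => μ.real {ω | π ω = ρ}) ?_ ?_ ?_ i j,
    key fun ρ => if ρ i = j then 1 else 0]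
  · simp
  · intro τ ρ
    simp only [measureReal_def, hπ, conj_mem_movesExactly]
  · simpa using (key fun _ => 1).symm
  · intro ρ hρ
    by_contra h
    refine hρ ?_
    rw [measureReal_def, hπ, if_neg (by simpa [movesExactly] using h), ENNReal.toReal_zero]

/-- in the shuffled linear model `yᵢ = x_{π*(i)}ᵀβ* + σ*εᵢ` with `X`
Gaussian, `ε` i.i.d. `N(0,1)` and `π*` uniform on the permutations moving exactly
`k` indices, all jointly independent, the expectation over `X` of the conditional
variance of `yᵢ` given `X` equals
`α*(1−α*)‖β*‖₂² + α*‖β*‖₂² − (α*²/(n−1))‖β*‖₂² + σ*²` with `α* = k/n`. -/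
theorem expected_conditional_variance (n d k : ℕ) (hn : 2 ≤ n) (hd : 1 ≤ d)
    (hk2 : 2 ≤ k) (hkn : k ≤ n)
    (β : Fin d → ℝ) (σ : ℝ) (hσ : 0 < σ) (α : ℝ) (hα : α = (k : ℝ) / n)
    (Ω : Type*) [MeasureSpace Ω] [IsProbabilityMeasure (ℙ : Measure Ω)]
    (X : Ω → Fin n → Fin d → ℝ) (ε : Ω → Fin n → ℝ) (π : Ω → Equiv.Perm (Fin n))
    (hXm : Measurable X) (hεm : Measurable ε) (hπm : Measurable π)
    -- the entries of X are independent N(0,1)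
    (hX : Measure.map X ℙ
      = Measure.pi fun _ : Fin n => Measure.pi fun _ : Fin d => gaussianReal 0 1)
    -- the entries of ε are i.i.d. N(0,1)
    (hε : Measure.map ε ℙ = Measure.pi fun _ : Fin n => gaussianReal 0 1)
    -- π* is uniform on the permutations moving exactly k indices
    (hπ : ∀ σ' : Equiv.Perm (Fin n), ℙ {ω | π ω = σ'} =
      if σ' ∈ movesExactly n k then ((movesExactly n k).card : ℝ≥0∞)⁻¹ else 0)
    -- X, ε, π* are jointly independent
    (hindep1 : IndepFun X (fun ω => (ε ω, π ω)) ℙ)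
    (hindep2 : IndepFun ε π ℙ)
    (y : Ω → Fin n → ℝ)
    (hy : y = fun ω i => (∑ l, X ω (π ω i) l * β l) + σ * ε ω i) :
    ∀ i : Fin n,
      ∫ ω, ((ℙ[fun ω' => (y ω' i) ^ 2|MeasurableSpace.comap X inferInstance]) ω
            - ((ℙ[fun ω' => y ω' i|MeasurableSpace.comap X inferInstance]) ω) ^ 2) ∂ℙ
        = α * (1 - α) * (∑ l, β l ^ 2) + α * (∑ l, β l ^ 2)
          - (α ^ 2 / ((n : ℝ) - 1)) * (∑ l, β l ^ 2) + σ ^ 2 := by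
  intro i
  have hXj : ∀ j, MeasurePreserving (fun ω => X ω j) ℙ
      (Measure.pi fun _ : Fin d => gaussianReal 0 1) := fun j =>
    (measurePreserving_eval (fun _ : Fin n => Measure.pi fun _ : Fin d => gaussianReal 0 1) j).comp
      ⟨hXm, hX⟩
  have hεi : MeasurePreserving (fun ω => ε ω i) ℙ (gaussianReal 0 1) :=
    (measurePreserving_eval (fun _ : Fin n => gaussianReal 0 1) i).comp ⟨hεm, hε⟩
  have hlin : Measurable fun v : Fin d → ℝ => ∑ l, v l * β l := by fun_prop
  have hsq : ∀ j, ∫ ω, (∑ l, X ω j l * β l) ^ 2 = ∑ l, β l ^ 2 := fun j => by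
    rw [← integral_gaussian_linear_sq, ← (hXj j).map_eq,
      integral_map (hXj j).measurable.aemeasurable (hlin.pow_const 2).aestronglyMeasurable]
  have h0 : ∀ j, ∫ ω, ∑ l, X ω j l * β l = 0 := fun j => by
    rw [← integral_gaussian_linear β, ← (hXj j).map_eq,
      integral_map (hXj j).measurable.aemeasurable hlin.aestronglyMeasurable]
  have hε0 : ∫ ω, ε ω i = 0 := by
    have h : ∫ x, x ∂gaussianReal 0 1 = 0 := by simp
    rw [← h, ← hεi.map_eq, integral_map hεi.measurable.aemeasurable
      (Measurable.aestronglyMeasurable (by fun_prop))]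
  have hε2 : ∫ ω, ε ω i ^ 2 = 1 := by
    rw [← integral_sq_gaussianReal_zero_one, ← hεi.map_eq,
      integral_map hεi.measurable.aemeasurable (Measurable.aestronglyMeasurable (by fun_prop))]
  set p : Fin n → ℝ := fun j => if j = i then 1 - (k : ℝ) / n else (k : ℝ) / n / (n - 1) with hp
  have hmix : ∫ ω, (∑ j, (∑ l, X ω j l * β l) * p j) ^ 2 = ∑ j, p j ^ 2 * ∑ l, β l ^ 2 := by
    rw [← integral_sum_mul_gaussian_linear_sq, ← hX, integral_map hXm.aemeasurable
      (Measurable.aestronglyMeasurable (by fun_prop))]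
  have happly : Measurable fun ρ : Equiv.Perm (Fin n) => ρ i := measurable_from_top
  have hind : IndepFun X (fun ω => (ε ω i, π ω i)) ℙ :=
    hindep1.comp (φ := id) (ψ := fun z : (Fin n → ℝ) × Equiv.Perm (Fin n) => (z.1 i, z.2 i))
      measurable_id
      (((measurable_pi_apply i).comp measurable_fst).prodMk (happly.comp measurable_snd))
  have hmain := integral_condVar_mixture (g := fun j (x : Fin n → Fin d → ℝ) => ∑ l, x j l * β l)
    hXm hεi.measurable (happly.comp hπm) hind
    ((memLp_id_gaussianReal' 2 (by simp)).comp_measurePreserving hεi) hε0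
    (fun j => by fun_prop) (fun j => (memLp_two_gaussian_linear β).comp_measurePreserving (hXj j))
    h0 σ p (integral_uniform_movesExactly_apply_eq hn hπm hπ i)
  subst hy
  refine hmain.trans ?_
  have hn1 : (n : ℝ) - 1 ≠ 0 := by
    have : (2 : ℝ) ≤ n := by exact_mod_cast hn
    linarith
  have hn0 : (n : ℝ) ≠ 0 := by positivity
  have hcard : ((Finset.univ.erase i).card : ℝ) = n - 1 := by
    rw [Finset.card_erase_of_mem (Finset.mem_univ i), Finset.card_univ, Fintype.card_fin,
      Nat.cast_sub (by omega), Nat.cast_one]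
  have hsum : ∀ F : ℝ → ℝ, ∑ j, F (p j)
      = F (1 - (k : ℝ) / n) + (n - 1) * F ((k : ℝ) / n / (n - 1)) := fun F => by
    rw [← Finset.add_sum_erase _ _ (Finset.mem_univ i), Finset.sum_congr rfl
      (g := fun _ => F ((k : ℝ) / n / (n - 1)))
      fun j hj => by simp [hp, Finset.ne_of_mem_erase hj], Finset.sum_const, nsmul_eq_mul, hcard]
    simp [hp]
  simp only [hsq, hmix, hε2]
  rw [← Finset.mul_sum, ← Finset.sum_mul, hsum fun t => t, hsum fun t => t ^ 2, hα]
  field_simp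
  ring
end
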